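/- arXiv:2012.15499 — 4 statements merged into one kernel-verified Lean document; each statement's English description precedes it below -/
import Mathlib

section
/- If ω is a Dini modulus of continuity, then ω(r)·log(1/r) tends to 0 as r tends to 0 from the right. -/
open MeasureTheory Set Filter

/-- **Lemma A.1.** If `ω` is a Dini modulus of continuity (a non-decreasing
function `ω : (0,1] → (0,∞)` with `ω(r) → 0` as `r → 0⁺` and `∫₀¹ ω(r)/r dr < ∞`),
then `ω(r) · log(1/r) → 0` as `r → 0⁺`. -/
theorem dini_mul_log_tendsto_zero (ω : ℝ → ℝ)
    (hpos : ∀ r ∈ Ioc (0:ℝ) 1, 0 < ω r)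
    (hmono : ∀ r ∈ Ioc (0:ℝ) 1, ∀ s ∈ Ioc (0:ℝ) 1, r ≤ s → ω r ≤ ω s)
    (hlim : Tendsto ω (nhdsWithin 0 (Ioi 0)) (nhds 0))
    (hdini : IntegrableOn (fun r => ω r / r) (Ioc (0:ℝ) 1)) :
    Tendsto (fun r => ω r * Real.log (1 / r)) (nhdsWithin 0 (Ioi 0)) (nhds 0) := by
  have hI : IntegrableOn (fun r => ω r / r) (Icc (0:ℝ) 1) :=
    (integrableOn_Icc_iff_integrableOn_Ioc (by simp)).mpr hdini
  have hc := intervalIntegral.continuousOn_primitive hI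
  have h0 : Tendsto (fun x => ∫ t in Ioc (0:ℝ) x, ω t / t) (nhdsWithin 0 (Icc 0 1)) (nhds 0) := by
    have := hc 0 (by simp)
    simpa [ContinuousWithinAt] using this
  have hsq : Tendsto Real.sqrt (nhdsWithin 0 (Ioi 0)) (nhdsWithin 0 (Icc 0 1)) := by
    apply tendsto_nhdsWithin_of_tendsto_nhds_of_eventually_within
    · have := Real.continuous_sqrt.tendsto 0
      rw [Real.sqrt_zero] at this
      exact this.mono_left nhdsWithin_le_nhds
    · filter_upwards [Ioc_mem_nhdsGT (zero_lt_one' ℝ)] with r hr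
      exact ⟨Real.sqrt_nonneg r, Real.sqrt_le_one.mpr hr.2⟩
  have hub := (h0.comp hsq).const_mul 2
  rw [mul_zero] at hub
  refine tendsto_of_tendsto_of_tendsto_of_le_of_le' tendsto_const_nhds hub ?_ ?_
  · filter_upwards [Ioc_mem_nhdsGT (zero_lt_one' ℝ)] with r hr
    have : 1 ≤ 1 / r := by rw [le_div_iff₀ hr.1]; linarith [hr.2]
    exact mul_nonneg (hpos r hr).le (Real.log_nonneg this)
  · filter_upwards [Ioc_mem_nhdsGT (zero_lt_one' ℝ)] with r hr
    have hs1 : Real.sqrt r ≤ 1 := Real.sqrt_le_one.mpr hr.2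
    have hs0 : 0 < Real.sqrt r := Real.sqrt_pos.mpr hr.1
    have hrs : r ≤ Real.sqrt r := by
      have := Real.mul_self_sqrt hr.1.le
      nlinarith
    have hsub : Ioc r (Real.sqrt r) ⊆ Ioc 0 (Real.sqrt r) := Ioc_subset_Ioc_left hr.1.le
    have hi : IntegrableOn (fun r => ω r / r) (Ioc 0 (Real.sqrt r)) :=
      hdini.mono_set (Ioc_subset_Ioc_right hs1)
    have h1 : ∫ t in Ioc r (Real.sqrt r), ω t / t ≤ ∫ t in Ioc 0 (Real.sqrt r), ω t / t := by
      apply setIntegral_mono_set hi _ hsub.eventuallyLE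
      filter_upwards [ae_restrict_mem measurableSet_Ioc] with t ht
      exact div_nonneg (hpos t ⟨ht.1, ht.2.trans hs1⟩).le ht.1.le
    have hii : IntervalIntegrable (fun t : ℝ => ω r * t⁻¹) volume r (Real.sqrt r) := by
      apply IntervalIntegrable.const_mul
      apply intervalIntegral.intervalIntegrable_inv (fun x hx => ?_) continuousOn_id
      rw [uIcc_of_le hrs] at hx
      exact (hr.1.trans_le hx.1).ne'
    have h2 : ∫ t in Ioc r (Real.sqrt r), ω r * t⁻¹ ≤ ∫ t in Ioc r (Real.sqrt r), ω t / t := by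
      apply setIntegral_mono_on
        ((intervalIntegrable_iff_integrableOn_Ioc_of_le hrs).mp hii) (hi.mono_set hsub)
        measurableSet_Ioc
      intro t ht
      have ht0 : 0 < t := hr.1.trans ht.1
      rw [div_eq_mul_inv]
      exact mul_le_mul_of_nonneg_right (hmono r hr t ⟨ht0, ht.2.trans hs1⟩ ht.1.le)
        (inv_nonneg.mpr ht0.le)
    have h3 : ∫ t in Ioc r (Real.sqrt r), ω r * t⁻¹ = ω r * (Real.log (1 / r) / 2) := by
      rw [← intervalIntegral.integral_of_le hrs, intervalIntegral.integral_const_mul,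
        integral_inv_of_pos hr.1 hs0, Real.log_div hs0.ne' hr.1.ne', Real.log_sqrt hr.1.le,
        one_div, Real.log_inv]
      ring
    simp only [Function.comp]
    linarith
end

section
/- Let ω be a Dini modulus of continuity. Then for every real α > 1, the integral ∫₀¹ r^{α/2 − 1} · ( ∫_r¹ ω(ρ)^{2α} / ρ^{α+1} dρ )^{1/2} dr is finite. -/
open MeasureTheory Set Filter

/-- Bounded (a.e.) measurable functions on `(r,1]` are integrable. -/
lemma dini_aux_integrable (g : ℝ → ℝ) (r C : ℝ)
    (hg : AEStronglyMeasurable g (volume.restrict (Ioc r (1:ℝ))))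
    (hC : ∀ ρ ∈ Ioc r (1:ℝ), ‖g ρ‖ ≤ C) : IntegrableOn g (Ioc r (1:ℝ)) := by
  refine Integrable.of_bound hg C ?_
  exact (ae_restrict_iff' measurableSet_Ioc).2 (Eventually.of_forall hC)

lemma dini_aux_tonelli (ω : ℝ → ℝ)
    (hpos : ∀ r ∈ Ioc (0:ℝ) 1, 0 < ω r)
    (hm : AEMeasurable ω (volume.restrict (Ioc (0:ℝ) 1)))
    (hdini : IntegrableOn (fun r => ω r / r) (Ioc (0:ℝ) 1))
    (a : ℝ) (ha : 0 < a) :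
    IntegrableOn (fun r => r ^ (a - 1) * ∫ s in Ioc r (1:ℝ), ω s * s ^ (-a - 1))
      (Ioc (0:ℝ) 1) := by
  set μ : Measure ℝ := volume.restrict (Ioc (0:ℝ) 1) with hμ
  let F : ℝ × ℝ → ℝ := indicator {p : ℝ × ℝ | p.1 < p.2}
    (fun p => p.1 ^ (a - 1) * (ω p.2 * p.2 ^ (-a - 1)))
  have hFm : AEStronglyMeasurable F (μ.prod μ) := by
    refine AEStronglyMeasurable.indicator ?_ (measurableSet_lt measurable_fst measurable_snd)
    have h1 : AEStronglyMeasurable (fun p : ℝ × ℝ => ω p.2) (μ.prod μ) :=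
      hm.aestronglyMeasurable.comp_snd
    have h2 : Measurable (fun p : ℝ × ℝ => p.1 ^ (a - 1)) := by fun_prop
    have h3 : Measurable (fun p : ℝ × ℝ => p.2 ^ (-a - 1)) := by fun_prop
    exact h2.aestronglyMeasurable.mul (h1.mul h3.aestronglyMeasurable)
  have hFs : ∀ s ∈ Ioc (0:ℝ) 1, (fun r => F (r, s)) =
      indicator (Iio s) (fun r => r ^ (a - 1) * (ω s * s ^ (-a - 1))) := by
    intro s hs
    ext r
    simp [F, indicator]
  have hI : ∀ s ∈ Ioc (0:ℝ) 1, Iio s ∩ Ioc (0:ℝ) 1 = Ioo 0 s := by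
    intro s hs
    ext r
    simp only [mem_inter_iff, mem_Iio, mem_Ioc, mem_Ioo]
    constructor
    · rintro ⟨h, h1, h2⟩; exact ⟨h1, h⟩
    · rintro ⟨h, h1⟩; exact ⟨h1, h, h1.le.trans hs.2⟩
  have hpow : ∀ s ∈ Ioc (0:ℝ) 1, IntegrableOn (fun r : ℝ => r ^ (a - 1)) (Ioo 0 s) := by
    intro s hs
    have := (intervalIntegral.intervalIntegrable_rpow' (a := 0) (b := s)
      (show -1 < a - 1 by linarith))
    rw [intervalIntegrable_iff_integrableOn_Ioo_of_le hs.1.le] at this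
    exact this
  have hF : Integrable F (μ.prod μ) := by
    rw [integrable_prod_iff' hFm]
    constructor
    · refine (ae_restrict_iff' measurableSet_Ioc).2 (Eventually.of_forall ?_)
      intro s hs
      rw [hFs s hs, integrable_indicator_iff measurableSet_Iio, IntegrableOn, hμ,
        Measure.restrict_restrict measurableSet_Iio, hI s hs]
      exact (hpow s hs).mul_const _
    · have hd : Integrable (fun s => ω s / s * a⁻¹) μ := hdini.mul_const _
      refine hd.congr ?_
      refine (ae_restrict_iff' measurableSet_Ioc).2 (Eventually.of_forall ?_)
      intro s hs
      have e1 : ∫ r, ‖F (r, s)‖ ∂μ = ∫ r, F (r, s) ∂μ := by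
        refine integral_congr_ae ?_
        refine (ae_restrict_iff' measurableSet_Ioc).2 (Eventually.of_forall ?_)
        intro r hr
        refine Real.norm_of_nonneg ?_
        refine indicator_apply_nonneg ?_
        intro _
        exact mul_nonneg (Real.rpow_nonneg hr.1.le _)
          (mul_nonneg (hpos s hs).le (Real.rpow_nonneg hs.1.le _))
      simp only []
      rw [e1, hFs s hs, integral_indicator measurableSet_Iio, hμ,
        Measure.restrict_restrict measurableSet_Iio, hI s hs, integral_mul_const,
        ← integral_Ioc_eq_integral_Ioo, ← intervalIntegral.integral_of_le hs.1.le,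
        integral_rpow (Or.inl (by linarith))]
      rw [sub_add_cancel, Real.zero_rpow ha.ne', sub_zero, Real.rpow_sub hs.1, Real.rpow_neg hs.1.le,
        Real.rpow_one]
      have := Real.rpow_pos_of_pos hs.1 a
      have := hs.1
      field_simp
  have := hF.integral_prod_left
  refine this.congr ?_
  refine (ae_restrict_iff' measurableSet_Ioc).2 (Eventually.of_forall ?_)
  intro r hr
  have e : (fun s => F (r, s)) =
      indicator (Ioi r) (fun s => r ^ (a - 1) * (ω s * s ^ (-a - 1))) := by
    ext s
    simp [F, indicator]
  have e2 : Ioi r ∩ Ioc (0:ℝ) 1 = Ioc r 1 := by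
    ext s
    simp only [mem_inter_iff, mem_Ioi, mem_Ioc]
    constructor
    · rintro ⟨h, h1, h2⟩; exact ⟨h, h2⟩
    · rintro ⟨h, h1⟩; exact ⟨h, hr.1.trans h, h1⟩
  simp only []
  rw [e, integral_indicator measurableSet_Ioi, hμ, Measure.restrict_restrict measurableSet_Ioi, e2,
    integral_const_mul]

/-- **Lemma A.2.** If `ω` is a Dini modulus of continuity, then for every `α > 1`,
`∫₀¹ r^(α/2 − 1) · ( ∫_r¹ ω(ρ)^(2α) / ρ^(α+1) dρ )^(1/2) dr < ∞`. -/
theorem dini_double_integral_finite (ω : ℝ → ℝ)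
    (hpos : ∀ r ∈ Ioc (0:ℝ) 1, 0 < ω r)
    (hmono : ∀ r ∈ Ioc (0:ℝ) 1, ∀ s ∈ Ioc (0:ℝ) 1, r ≤ s → ω r ≤ ω s)
    (hlim : Tendsto ω (nhdsWithin 0 (Ioi 0)) (nhds 0))
    (hdini : IntegrableOn (fun r => ω r / r) (Ioc (0:ℝ) 1))
    (α : ℝ) (hα : 1 < α) :
    IntegrableOn
      (fun r => r ^ (α / 2 - 1) *
        Real.sqrt (∫ ρ in Ioc r (1:ℝ), ω ρ ^ (2 * α) / ρ ^ (α + 1)))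
      (Ioc (0:ℝ) 1) := by
  obtain ⟨a, rfl⟩ : ∃ a, α = 2 * a := ⟨α / 2, by ring⟩
  have ha : 0 < a := by linarith
  have haa : 2 * a / 2 = a := by ring
  rw [haa]
  have hm : AEMeasurable ω (volume.restrict (Ioc (0:ℝ) 1)) :=
    aemeasurable_restrict_of_monotoneOn measurableSet_Ioc (fun r hr s hs h => hmono r hr s hs h)
  have h11 : (1:ℝ) ∈ Ioc (0:ℝ) 1 := by simp
  set M := ω 1 with hM
  have hM0 : 0 < M := hpos 1 h11
  have hωM : ∀ r ∈ Ioc (0:ℝ) 1, ω r ≤ M := fun r hr => hmono r hr 1 h11 hr.2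
  have hsub : ∀ r ∈ Ioc (0:ℝ) 1, Ioc r (1:ℝ) ⊆ Ioc 0 1 := fun r hr =>
    Ioc_subset_Ioc_left hr.1.le
  have hmr : ∀ r ∈ Ioc (0:ℝ) 1, AEMeasurable ω (volume.restrict (Ioc r (1:ℝ))) := fun r hr =>
    hm.mono_measure (Measure.restrict_mono (hsub r hr) le_rfl)
  -- the inner integrands
  set g : ℝ → ℝ := fun ρ => ω ρ ^ (2 * (2 * a)) / ρ ^ (2 * a + 1) with hg
  set k : ℝ → ℝ := fun s => ω s * s ^ (-a - 1) with hk
  have hg0 : ∀ ρ ∈ Ioc (0:ℝ) 1, 0 ≤ g ρ := fun ρ hρ =>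
    div_nonneg (Real.rpow_nonneg (hpos ρ hρ).le _) (Real.rpow_nonneg hρ.1.le _)
  have hk0 : ∀ ρ ∈ Ioc (0:ℝ) 1, 0 ≤ k ρ := fun ρ hρ =>
    mul_nonneg (hpos ρ hρ).le (Real.rpow_nonneg hρ.1.le _)
  have hgi : ∀ r ∈ Ioc (0:ℝ) 1, IntegrableOn g (Ioc r 1) := by
    intro r hr
    refine dini_aux_integrable g r (M ^ (2 * (2 * a)) / r ^ (2 * a + 1)) ?_ ?_
    · exact (((hmr r hr).pow_const _).div (by fun_prop)).aestronglyMeasurable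
    · intro ρ hρ
      have hρ' := hsub r hr hρ
      rw [Real.norm_of_nonneg (hg0 ρ hρ')]
      have h1 := Real.rpow_le_rpow (hpos ρ hρ').le (hωM ρ hρ') (show 0 ≤ 2 * (2 * a) by linarith)
      have h2 := Real.rpow_le_rpow hr.1.le hρ.1.le (show 0 ≤ 2 * a + 1 by linarith)
      exact div_le_div₀ (Real.rpow_nonneg hM0.le _) h1 (Real.rpow_pos_of_pos hr.1 _) h2
  have hki : ∀ r ∈ Ioc (0:ℝ) 1, IntegrableOn k (Ioc r 1) := by
    intro r hr
    refine dini_aux_integrable k r (M * r ^ (-a - 1)) ?_ ?_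
    · exact ((hmr r hr).mul (by fun_prop)).aestronglyMeasurable
    · intro ρ hρ
      have hρ' := hsub r hr hρ
      rw [Real.norm_of_nonneg (hk0 ρ hρ')]
      have h2 := Real.rpow_le_rpow_of_nonpos hr.1 hρ.1.le (show -a - 1 ≤ 0 by linarith)
      exact mul_le_mul (hωM ρ hρ') h2 (Real.rpow_nonneg hρ'.1.le _) hM0.le
  set K : ℝ → ℝ := fun r => ∫ s in Ioc r (1:ℝ), k s with hK
  have hKint : IntegrableOn (fun r => r ^ (a - 1) * K r) (Ioc (0:ℝ) 1) :=
    dini_aux_tonelli ω hpos hm hdini a ha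
  have hpowi : IntegrableOn (fun r : ℝ => r ^ (a - 1)) (Ioc (0:ℝ) 1) := by
    have := (intervalIntegral.intervalIntegrable_rpow' (a := 0) (b := 1)
      (show -1 < a - 1 by linarith))
    rwa [intervalIntegrable_iff_integrableOn_Ioc_of_le zero_le_one] at this
  have hKanti : ∀ r ∈ Ioc (0:ℝ) 1, ∀ s ∈ Ioc (0:ℝ) 1, r ≤ s → K s ≤ K r := by
    intro r hr s hs hrs
    refine setIntegral_mono_set (hki r hr) ?_ (Ioc_subset_Ioc_left hrs).eventuallyLE
    exact (ae_restrict_iff' measurableSet_Ioc).2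
      (Eventually.of_forall fun ρ hρ => hk0 ρ (hsub r hr hρ))
  have hGanti : AntitoneOn (fun r => ∫ ρ in Ioc r (1:ℝ), g ρ) (Ioc (0:ℝ) 1) := by
    intro r hr s hs hrs
    refine setIntegral_mono_set (hgi r hr) ?_ (Ioc_subset_Ioc_left hrs).eventuallyLE
    exact (ae_restrict_iff' measurableSet_Ioc).2
      (Eventually.of_forall fun ρ hρ => hg0 ρ (hsub r hr hρ))
  have hGm := aemeasurable_restrict_of_antitoneOn (μ := volume) measurableSet_Ioc hGanti
  -- pointwise bound
  have hpt : ∀ ρ ∈ Ioc (0:ℝ) 1, ω ρ * ρ ^ (-a) ≤ a * K ρ + M := by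
    intro ρ hρ
    have hpi : IntegrableOn (fun s : ℝ => s ^ (-a - 1)) (Ioc ρ 1) := by
      have : IntervalIntegrable (fun s : ℝ => s ^ (-a - 1)) volume ρ 1 := by
        refine intervalIntegral.intervalIntegrable_rpow (Or.inr ?_)
        rw [uIcc_of_le hρ.2]
        exact fun h => absurd h.1 (not_le.2 hρ.1)
      rwa [intervalIntegrable_iff_integrableOn_Ioc_of_le hρ.2] at this
    have h1 : ∫ s in Ioc ρ (1:ℝ), ω ρ * s ^ (-a - 1) ≤ K ρ := by
      refine setIntegral_mono_on (hpi.const_mul _) (hki ρ hρ) measurableSet_Ioc ?_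
      intro s hs
      have hs' := hsub ρ hρ hs
      exact mul_le_mul_of_nonneg_right (hmono ρ hρ s hs' hs.1.le) (Real.rpow_nonneg hs'.1.le _)
    rw [integral_const_mul, ← intervalIntegral.integral_of_le hρ.2, integral_rpow
      (Or.inr ⟨by linarith, by
        rw [uIcc_of_le hρ.2]
        exact fun h => absurd h.1 (not_le.2 hρ.1)⟩), sub_add_cancel, Real.one_rpow] at h1
    have h2 : a * (ω ρ * ((1 - ρ ^ (-a)) / -a)) = ω ρ * ρ ^ (-a) - ω ρ := by
      field_simp
      ring
    have h3 := mul_le_mul_of_nonneg_left h1 ha.le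
    have h4 := hωM ρ hρ
    linarith
  set c := M ^ (2 * (2 * a) - 2) with hc
  have hc0 : 0 ≤ c := Real.rpow_nonneg hM0.le _
  have hK0 : ∀ r ∈ Ioc (0:ℝ) 1, 0 ≤ K r := fun r hr =>
    setIntegral_nonneg measurableSet_Ioc fun s hs => hk0 s (hsub r hr hs)
  have hG : ∀ r ∈ Ioc (0:ℝ) 1,
      ∫ ρ in Ioc r (1:ℝ), g ρ ≤ c * (a * K r + M) * K r := by
    intro r hr
    rw [hK, ← integral_const_mul]
    refine setIntegral_mono_on (hgi r hr) ((hki r hr).const_mul _) measurableSet_Ioc ?_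
    intro ρ hρ
    have hρ' := hsub r hr hρ
    have hω := hpos ρ hρ'
    have e : g ρ = ω ρ ^ (2 * (2 * a) - 2) * (ω ρ * ρ ^ (-a)) * k ρ := by
      have e1 : ω ρ ^ (2 * (2 * a)) = ω ρ ^ (2 * (2 * a) - 2) * (ω ρ * ω ρ) := by
        rw [← sq, ← Real.rpow_two, ← Real.rpow_add hω]; congr 1; ring
      have e2 : (ρ ^ (2 * a + 1))⁻¹ = ρ ^ (-a) * ρ ^ (-a - 1) := by
        rw [← Real.rpow_neg hρ'.1.le, ← Real.rpow_add hρ'.1]; congr 1; ring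
      simp only [hg, hk]
      rw [div_eq_mul_inv, e1, e2]; ring
    rw [e]
    refine mul_le_mul_of_nonneg_right ?_ (hk0 ρ hρ')
    refine mul_le_mul (Real.rpow_le_rpow hω.le (hωM ρ hρ') (by linarith)) ?_
      (mul_nonneg hω.le (Real.rpow_nonneg hρ'.1.le _)) hc0
    have := mul_le_mul_of_nonneg_left (hKanti r hr ρ hρ' hρ.1.le) ha.le
    exact (hpt ρ hρ').trans (by linarith)
  have hdom : IntegrableOn (fun r => ((c * a + 1) / 2) * (r ^ (a - 1) * K r)
      + (c * M / 2) * r ^ (a - 1)) (Ioc (0:ℝ) 1) :=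
    (hKint.const_mul _).add (hpowi.const_mul _)
  refine Integrable.mono' hdom ?_ ?_
  · have h2 : AEMeasurable (fun r : ℝ => r ^ (a - 1)) (volume.restrict (Ioc (0:ℝ) 1)) := by
      fun_prop
    exact (h2.mul hGm.sqrt).aestronglyMeasurable
  · refine (ae_restrict_iff' measurableSet_Ioc).2 (Eventually.of_forall ?_)
    intro r hr
    have hr0 := Real.rpow_nonneg hr.1.le (a - 1)
    rw [Real.norm_of_nonneg (mul_nonneg hr0 (Real.sqrt_nonneg _))]
    have hk' := hK0 r hr
    have hH : 0 ≤ c * (a * K r + M) := by positivity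
    have hs : Real.sqrt (∫ ρ in Ioc r (1:ℝ), g ρ) ≤ (c * (a * K r + M) + K r) / 2 := by
      refine Real.sqrt_le_iff.2 ⟨by linarith, (hG r hr).trans ?_⟩
      nlinarith [sq_nonneg (c * (a * K r + M) - K r)]
    refine (mul_le_mul_of_nonneg_left hs hr0).trans (le_of_eq ?_)
    ring
end

section
/- Let ω be a Dini modulus of continuity and let n ≥ 1 be an integer. Define ψ(ρ) = ρ^{n/2} + ( ρⁿ ∫_ρ¹ ω(τ)^{3n} / τ^{n+1} dτ )^{1/2} + ω(ρ) for ρ ∈ (0, 1/2). Then ∫₀^{1/2} ψ(ρ)/ρ dρ < ∞. -/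
open MeasureTheory Set Filter

lemma aux_int (w : ℝ → ℝ) (hm : Monotone w) (p : ℝ) (ρ : ℝ) (h0 : 0 < ρ) :
    IntegrableOn (fun s => w s * s ^ p) (Ioc ρ 1) := by
  have h1 : IntegrableOn w (Icc ρ 1) :=
    (hm.monotoneOn _).integrableOn_isCompact isCompact_Icc
  have h2 : ContinuousOn (fun s : ℝ => s ^ p) (Icc ρ 1) := by
    intro x hx
    exact (Real.continuousAt_rpow_const x p (Or.inl (by linarith [hx.1]))).continuousWithinAt
  exact (h1.mul_continuousOn h2 isCompact_Icc).mono_set Ioc_subset_Icc_self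

lemma aux_fubini (w : ℝ → ℝ) (hm : Monotone w) (h0 : ∀ x, 0 ≤ w x)
    (hd : IntegrableOn (fun r => w r / r) (Ioc (0:ℝ) 1)) (a : ℝ) (ha : 0 < a) :
    IntegrableOn (fun ρ => ρ ^ (a - 1) * ∫ s in Ioc ρ 1, w s * s ^ (-a - 1)) (Ioc (0:ℝ) 1) := by
  set μ := volume.restrict (Ioc (0:ℝ) 1) with hμ
  let f : ℝ × ℝ → ℝ := fun z =>
    {z : ℝ × ℝ | z.1 < z.2}.indicator (fun z => z.1 ^ (a - 1) * (w z.2 * z.2 ^ (-a - 1))) z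
  have hmeas : Measurable f := by
    refine Measurable.indicator ?_ (measurableSet_lt measurable_fst measurable_snd)
    have := hm.measurable
    fun_prop
  have hrp : IntegrableOn (fun ρ : ℝ => ρ ^ (a - 1)) (Ioc (0:ℝ) 1) :=
    (intervalIntegrable_iff_integrableOn_Ioc_of_le zero_le_one).1
      (intervalIntegral.intervalIntegrable_rpow' (by linarith))
  have hf : Integrable f (μ.prod μ) := by
    rw [integrable_prod_iff' hmeas.aestronglyMeasurable]
    constructor
    · refine Eventually.of_forall fun s => ?_
      have : (fun x => f (x, s)) = (Iio s).indicator
          (fun x => x ^ (a - 1) * (w s * s ^ (-a - 1))) := by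
        funext x; simp [f, indicator]
      rw [this]
      exact (Integrable.mul_const hrp _).indicator measurableSet_Iio
    · refine Integrable.congr (f := fun s => (1 / a) * (w s / s)) (hd.const_mul _) ?_
      rw [hμ]
      filter_upwards [ae_restrict_mem measurableSet_Ioc] with s hs
      have hs0 : 0 < s := hs.1
      have e1 : ∫ x, ‖f (x, s)‖ ∂μ =
          ∫ x in Ioc (0:ℝ) 1, (Iio s).indicator
            (fun x => x ^ (a - 1) * (w s * s ^ (-a - 1))) x := by
        refine setIntegral_congr_fun measurableSet_Ioc fun x hx => ?_
        have hx0 : 0 < x := hx.1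
        have := h0 s
        by_cases h : x < s
        · simp only [f, indicator, mem_setOf_eq, h, mem_Iio, if_true]
          rw [Real.norm_of_nonneg (by positivity)]
        · simp [f, indicator, h]
      have e2 : Ioc (0:ℝ) 1 ∩ Iio s = Ioo 0 s := by
        ext x; simp only [mem_inter_iff, mem_Ioc, mem_Iio, mem_Ioo]
        constructor
        · rintro ⟨⟨h, _⟩, h'⟩; exact ⟨h, h'⟩
        · rintro ⟨h, h'⟩; exact ⟨⟨h, by linarith [hs.2]⟩, h'⟩
      change _ = ∫ x, ‖f (x, s)‖ ∂μ
      rw [e1, setIntegral_indicator measurableSet_Iio, e2, ← integral_Ioc_eq_integral_Ioo,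
        integral_mul_const, ← intervalIntegral.integral_of_le hs0.le,
        integral_rpow (Or.inl (by linarith))]
      have : a - 1 + 1 = a := by ring
      rw [this, Real.zero_rpow ha.ne', show -a - 1 = -(a) + (-1) by ring,
        Real.rpow_add hs0, Real.rpow_neg hs0.le, Real.rpow_neg_one]
      have : s ^ a ≠ 0 := (Real.rpow_pos_of_pos hs0 a).ne'
      field_simp
      try ring
  refine hf.integral_prod_left.congr ?_
  rw [hμ]
  filter_upwards [ae_restrict_mem measurableSet_Ioc] with ρ hρ
  have : (fun s => f (ρ, s)) = (Ioi ρ).indicator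
      (fun s => ρ ^ (a - 1) * (w s * s ^ (-a - 1))) := by
    funext x; simp [f, indicator]
  have e2 : Ioc (0:ℝ) 1 ∩ Ioi ρ = Ioc ρ 1 := by
    ext x; simp only [mem_inter_iff, mem_Ioc, mem_Ioi]
    constructor
    · rintro ⟨⟨_, h⟩, h'⟩; exact ⟨h', h⟩
    · rintro ⟨h, h'⟩; exact ⟨⟨by linarith [hρ.1], h'⟩, h⟩
  rw [this, setIntegral_indicator measurableSet_Ioi, e2, integral_const_mul]

lemma aux_pt (w : ℝ → ℝ) (hm : Monotone w) (h0 : ∀ x, 0 ≤ w x) (a : ℝ) (ha : 0 < a)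
    (ρ τ : ℝ) (hρ : 0 < ρ) (h1 : ρ < τ) (h2 : τ ≤ 1) :
    w τ * τ ^ (-a) ≤ a * (∫ s in Ioc ρ 1, w s * s ^ (-a - 1)) + w 1 := by
  have hτ : 0 < τ := hρ.trans h1
  have A : ∫ s in Ioc τ 1, w τ * s ^ (-a - 1) ≤ ∫ s in Ioc ρ 1, w s * s ^ (-a - 1) := by
    calc _ ≤ ∫ s in Ioc τ 1, w s * s ^ (-a - 1) := by
          refine setIntegral_mono_on ?_ (aux_int w hm _ τ hτ) measurableSet_Ioc ?_
          · exact aux_int (fun _ => w τ) monotone_const _ τ hτ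
          · intro s hs
            have : 0 < s := hτ.trans hs.1
            exact mul_le_mul_of_nonneg_right (hm hs.1.le) (by positivity)
      _ ≤ _ := by
          refine setIntegral_mono_set (aux_int w hm _ ρ hρ) ?_
            (Ioc_subset_Ioc_left h1.le).eventuallyLE
          filter_upwards [ae_restrict_mem measurableSet_Ioc] with s hs
          have : 0 < s := hρ.trans hs.1
          have := h0 s
          simp only [Pi.zero_apply]
          positivity
  rw [integral_const_mul, ← intervalIntegral.integral_of_le h2,
    integral_rpow (Or.inr ⟨by linarith, by
      rw [uIcc_of_le h2]; intro h; linarith [h.1]⟩)] at A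
  rw [show -a - 1 + 1 = -a by ring, Real.one_rpow] at A
  have e : w τ * ((1 - τ ^ (-a)) / -a) = (w τ * τ ^ (-a) - w τ) / a := by
    field_simp; ring
  rw [e, div_le_iff₀ ha] at A
  have := hm h2
  linarith

lemma aux_core (w : ℝ → ℝ) (hm : Monotone w) (h0 : ∀ x, 0 ≤ w x)
    (hd : IntegrableOn (fun r => w r / r) (Ioc (0:ℝ) 1)) (n : ℕ) (hn : 1 ≤ n) :
    IntegrableOn (fun ρ =>
      Real.sqrt (ρ ^ n * ∫ τ in Ioc ρ (1:ℝ), w τ ^ (3 * n) / τ ^ (n + 1)) / ρ)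
      (Ioc (0:ℝ) 1) := by
  obtain ⟨a, ha⟩ : ∃ a : ℝ, a = n / 2 := ⟨_, rfl⟩
  have hn' : (1:ℝ) ≤ n := by exact_mod_cast hn
  have ha0 : 0 < a := by rw [ha]; positivity
  have hint : ∀ ρ : ℝ, 0 < ρ →
      IntegrableOn (fun τ => w τ ^ (3 * n) / τ ^ (n + 1)) (Ioc ρ 1) := by
    intro ρ hρ
    have hm3 : Monotone fun τ => w τ ^ (3 * n) := fun x y h => pow_le_pow_left₀ (h0 x) (hm h) _
    refine (aux_int _ hm3 (-((n + 1 : ℕ) : ℝ)) ρ hρ).congr_fun ?_ measurableSet_Ioc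
    intro s hs
    have : 0 < s := hρ.trans hs.1
    simp only []
    rw [Real.rpow_neg this.le, Real.rpow_natCast, div_eq_mul_inv]
  have hanti : AntitoneOn (fun ρ => ∫ τ in Ioc ρ (1:ℝ), w τ ^ (3 * n) / τ ^ (n + 1))
      (Ioc (0:ℝ) 1) := by
    intro x hx y hy hxy
    refine setIntegral_mono_set (hint x hx.1) ?_ (Ioc_subset_Ioc_left hxy).eventuallyLE
    filter_upwards [ae_restrict_mem measurableSet_Ioc] with s hs
    have : 0 < s := hx.1.trans hs.1
    have := h0 s
    simp only [Pi.zero_apply]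
    positivity
  have hF := aemeasurable_restrict_of_antitoneOn (μ := volume) measurableSet_Ioc hanti
  have hrp : IntegrableOn (fun ρ : ℝ => ρ ^ (a - 1)) (Ioc (0:ℝ) 1) :=
    (intervalIntegrable_iff_integrableOn_Ioc_of_le zero_le_one).1
      (intervalIntegral.intervalIntegrable_rpow' (by linarith))
  set C := w 1 ^ (3 * n - 2) with hC
  have hC0 : 0 ≤ C := pow_nonneg (h0 1) _
  have hdom := (((aux_fubini w hm h0 hd a ha0).const_mul (a + 1)).add
    (hrp.const_mul (w 1))).const_mul (Real.sqrt C)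
  refine Integrable.mono' hdom ?_ ?_
  · refine AEMeasurable.aestronglyMeasurable ?_
    refine AEMeasurable.div ?_ aemeasurable_id
    exact (((measurable_id.pow_const n).aemeasurable).mul hF).sqrt
  filter_upwards [ae_restrict_mem measurableSet_Ioc] with ρ hρ
  have hρ0 : 0 < ρ := hρ.1
  simp only [Pi.add_apply]
  rw [Real.norm_of_nonneg (by positivity), div_le_iff₀ hρ0]
  set G := ∫ s in Ioc ρ 1, w s * s ^ (-a - 1) with hG
  have hG0 : 0 ≤ G := by
    refine setIntegral_nonneg measurableSet_Ioc fun s hs => ?_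
    have : 0 < s := hρ0.trans hs.1
    have := h0 s
    positivity
  have hw1 := h0 1
  have hI : ∫ τ in Ioc ρ (1:ℝ), w τ ^ (3 * n) / τ ^ (n + 1) ≤ C * (a * G + w 1) * G := by
    rw [hG, ← integral_const_mul]
    refine setIntegral_mono_on (hint ρ hρ0) ((aux_int w hm _ ρ hρ0).const_mul _)
      measurableSet_Ioc fun s hs => ?_
    have hs0 : 0 < s := hρ0.trans hs.1
    have hws := h0 s
    have hp := aux_pt w hm h0 a ha0 ρ s hρ0 hs.1 hs.2
    have e1 : w s ^ (3 * n) ≤ C * w s ^ 2 := by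
      rw [show 3 * n = (3 * n - 2) + 2 by omega, pow_add]
      exact mul_le_mul_of_nonneg_right (pow_le_pow_left₀ hws (hm hs.2) _) (by positivity)
    have e2 : (s ^ (n + 1))⁻¹ = s ^ (-a) * s ^ (-a - 1) := by
      rw [← Real.rpow_add hs0, ← Real.rpow_natCast, ← Real.rpow_neg hs0.le]
      congr 1; rw [ha]; push_cast; ring
    calc w s ^ (3 * n) / s ^ (n + 1) ≤ C * w s ^ 2 * (s ^ (n + 1))⁻¹ := by
          rw [div_eq_mul_inv]; exact mul_le_mul_of_nonneg_right e1 (by positivity)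
      _ = C * (w s * s ^ (-a)) * (w s * s ^ (-a - 1)) := by rw [e2]; ring
      _ ≤ _ := by
          refine mul_le_mul_of_nonneg_right (mul_le_mul_of_nonneg_left hp hC0) (by positivity)
  have hr : ρ ^ (a - 1) * ρ = ρ ^ a := by
    rw [Real.rpow_sub_one hρ0.ne']; field_simp
  have hr2 : ρ ^ n = (ρ ^ a) ^ 2 := by
    rw [← Real.rpow_natCast, ← Real.rpow_natCast, ← Real.rpow_mul hρ0.le]
    congr 1; rw [ha]; push_cast; ring
  have hR : √C * ((a + 1) * (ρ ^ (a - 1) * G) + w 1 * ρ ^ (a - 1)) * ρ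
      = √C * (ρ ^ a * ((a + 1) * G + w 1)) := by rw [← hr]; ring
  rw [hR]
  refine Real.sqrt_le_iff.2 ⟨by positivity, ?_⟩
  rw [mul_pow, Real.sq_sqrt hC0, mul_pow, hr2]
  calc _ ≤ (ρ ^ a) ^ 2 * (C * (a * G + w 1) * G) := mul_le_mul_of_nonneg_left hI (by positivity)
    _ = C * ((ρ ^ a) ^ 2 * ((a * G + w 1) * G)) := by ring
    _ ≤ _ := by
      gcongr
      have : 0 ≤ a * G + w 1 := by positivity
      nlinarith [mul_nonneg this hG0, mul_nonneg this this]

/-- The modulus `ψ(ρ) = ρ^{n/2} + (ρⁿ ∫_ρ¹ ω(τ)^{3n}/τ^{n+1} dτ)^{1/2} + ω(ρ)`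
from (2.16) satisfies the Dini condition `∫₀^{1/2} ψ(ρ)/ρ dρ < ∞`, whenever `ω`
is a Dini modulus of continuity and `n ≥ 1`. -/
theorem psi_dini (ω : ℝ → ℝ)
    (hpos : ∀ r ∈ Ioc (0:ℝ) 1, 0 < ω r)
    (hmono : ∀ r ∈ Ioc (0:ℝ) 1, ∀ s ∈ Ioc (0:ℝ) 1, r ≤ s → ω r ≤ ω s)
    (hlim : Tendsto ω (nhdsWithin 0 (Ioi 0)) (nhds 0))
    (hdini : IntegrableOn (fun r => ω r / r) (Ioc (0:ℝ) 1))
    (n : ℕ) (hn : 1 ≤ n) :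
    IntegrableOn
      (fun ρ =>
        (ρ ^ ((n : ℝ) / 2) +
          Real.sqrt (ρ ^ n * ∫ τ in Ioc ρ (1:ℝ), ω τ ^ (3 * n) / τ ^ (n + 1)) +
          ω ρ) / ρ)
      (Ioc (0:ℝ) (1/2)) := by
  let w : ℝ → ℝ := fun x => if x ≤ 0 then 0 else ω (min x 1)
  have hmem : ∀ x : ℝ, 0 < x → min x 1 ∈ Ioc (0:ℝ) 1 := fun x hx =>
    ⟨lt_min hx one_pos, min_le_right _ _⟩
  have h0 : ∀ x, 0 ≤ w x := by
    intro x
    by_cases h : x ≤ 0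
    · simp [w, h]
    · simp only [w, h, if_false]
      exact (hpos _ (hmem x (not_le.1 h))).le
  have hm : Monotone w := by
    intro x y hxy
    by_cases h : x ≤ 0
    · have : w x = 0 := by simp [w, h]
      rw [this]; exact h0 y
    · have hx := not_le.1 h
      have hy := hx.trans_le hxy
      simp only [w, h, not_le.2 hy, if_false]
      exact hmono _ (hmem x hx) _ (hmem y hy) (min_le_min_right _ hxy)
  have hw : ∀ x ∈ Ioc (0:ℝ) 1, w x = ω x := by
    intro x hx
    simp [w, not_le.2 hx.1, min_eq_left hx.2]
  have hd : IntegrableOn (fun r => w r / r) (Ioc (0:ℝ) 1) :=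
    hdini.congr_fun (fun x hx => by simp only [hw x hx]) measurableSet_Ioc
  have hcore := aux_core w hm h0 hd n hn
  have hn' : (1:ℝ) ≤ n := by exact_mod_cast hn
  have hrp : IntegrableOn (fun ρ : ℝ => ρ ^ ((n:ℝ) / 2 - 1)) (Ioc (0:ℝ) 1) :=
    (intervalIntegrable_iff_integrableOn_Ioc_of_le zero_le_one).1
      (intervalIntegral.intervalIntegrable_rpow' (by linarith))
  have hsum := (hrp.add hcore).add hdini
  have hfin := hsum.mono_set (Ioc_subset_Ioc_right (by norm_num : (1/2:ℝ) ≤ 1))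
  refine IntegrableOn.congr_fun hfin ?_ measurableSet_Ioc
  intro ρ hρ
  have e : ∫ τ in Ioc ρ (1:ℝ), w τ ^ (3 * n) / τ ^ (n + 1)
      = ∫ τ in Ioc ρ (1:ℝ), ω τ ^ (3 * n) / τ ^ (n + 1) :=
    setIntegral_congr_fun measurableSet_Ioc fun s hs => by
      simp only [hw s ⟨hρ.1.trans hs.1, hs.2⟩]
  simp only [Pi.add_apply]
  rw [e, Real.rpow_sub_one hρ.1.ne', add_div, add_div]
end

section
/- Let ω be a Dini modulus of continuity and let n ≥ 1 be an integer. Then ∫₀^{1/2} ρ^{(n+2)/2 − 1} · ( ∫_ρ¹ ω(τ)^{3n+4} / τ^{n+3} dτ )^{1/2} dρ < ∞, and lim_{ρ→0⁺} ρ^{n+2} ∫_ρ¹ ω(τ)^{3n+4} / τ^{n+3} dτ = 0. -/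
open MeasureTheory Set Filter

/-- the truncated integral is integrable in the lower endpoint -/
lemma psi_aux_H (ω : ℝ → ℝ)
    (hpos : ∀ r ∈ Ioc (0:ℝ) 1, 0 < ω r)
    (hdini : IntegrableOn (fun r => ω r / r) (Ioc (0:ℝ) 1)) :
    IntegrableOn (fun ρ => ∫ τ in Ioc ρ (1:ℝ), ω τ / τ ^ 2) (Ioc (0:ℝ) 1) := by
  set μ : Measure ℝ := volume.restrict (Ioc (0:ℝ) 1) with hμ
  have hg : AEStronglyMeasurable (fun τ => ω τ / τ ^ 2) μ := by
    have h1 : AEStronglyMeasurable (fun τ : ℝ => (ω τ / τ) * τ⁻¹) μ :=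
      hdini.aestronglyMeasurable.mul (measurable_inv.aestronglyMeasurable)
    refine h1.congr (Eventually.of_forall fun τ => ?_)
    simp only [div_eq_mul_inv, pow_two, mul_inv, mul_assoc]
  have hS : MeasurableSet {z : ℝ × ℝ | z.1 < z.2} :=
    measurableSet_lt measurable_fst measurable_snd
  have hf : AEStronglyMeasurable
      ({z : ℝ × ℝ | z.1 < z.2}.indicator (fun z => ω z.2 / z.2 ^ 2)) (μ.prod μ) :=
    (hg.comp_snd (μ := μ)).indicator hS
  have hint : Integrable
      ({z : ℝ × ℝ | z.1 < z.2}.indicator (fun z => ω z.2 / z.2 ^ 2)) (μ.prod μ) := by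
    rw [integrable_prod_iff' hf]
    have key : ∀ τ : ℝ, (fun ρ : ℝ => {z : ℝ × ℝ | z.1 < z.2}.indicator
        (fun z => ω z.2 / z.2 ^ 2) (ρ, τ)) = (Iio τ).indicator (fun _ => ω τ / τ ^ 2) := by
      intro τ
      ext ρ
      simp [indicator]
    constructor
    · refine Eventually.of_forall fun τ => ?_
      rw [key]
      exact (integrable_const _).indicator measurableSet_Iio
    · refine Integrable.congr hdini ?_
      filter_upwards [ae_restrict_mem measurableSet_Ioc] with τ hτ
      have e1 : (fun ρ : ℝ => ‖{z : ℝ × ℝ | z.1 < z.2}.indicator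
        (fun z => ω z.2 / z.2 ^ 2) (ρ, τ)‖) = (Iio τ).indicator (fun _ => ω τ / τ ^ 2) := by
        ext ρ
        have := congrFun (key τ) ρ
        rw [this, Real.norm_of_nonneg]
        exact indicator_nonneg (fun _ _ => div_nonneg (hpos τ hτ).le (by positivity)) _
      rw [e1, integral_indicator measurableSet_Iio, hμ,
        Measure.restrict_restrict measurableSet_Iio]
      have e2 : Iio τ ∩ Ioc (0:ℝ) 1 = Ioo 0 τ := by
        ext x
        simp only [mem_inter_iff, mem_Iio, mem_Ioc, mem_Ioo]
        constructor
        · rintro ⟨h1, h2, h3⟩; exact ⟨h2, h1⟩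
        · rintro ⟨h1, h2⟩; exact ⟨h2, h1, h2.le.trans hτ.2⟩
      have h0 := hτ.1
      rw [e2]
      simp [h0.le]
      field_simp
  have := hint.integral_prod_left
  refine Integrable.congr this ?_
  filter_upwards [ae_restrict_mem measurableSet_Ioc] with ρ hρ
  have e1 : (fun τ : ℝ => {z : ℝ × ℝ | z.1 < z.2}.indicator
        (fun z => ω z.2 / z.2 ^ 2) (ρ, τ)) = (Ioi ρ).indicator (fun τ => ω τ / τ ^ 2) := by
    ext τ
    simp [indicator]
  rw [e1, integral_indicator measurableSet_Ioi, hμ,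
        Measure.restrict_restrict measurableSet_Ioi]
  congr 2
  ext x
  simp only [mem_inter_iff, mem_Ioi, mem_Ioc]
  constructor
  · rintro ⟨h1, h2, h3⟩; exact ⟨h1, h3⟩
  · rintro ⟨h1, h2⟩; exact ⟨h1, hρ.1.trans h1, h2⟩

/-- `ρ ∫_ρ¹ ω/τ² → 0` by dominated convergence -/
lemma psi_aux_lim (ω : ℝ → ℝ)
    (hpos : ∀ r ∈ Ioc (0:ℝ) 1, 0 < ω r)
    (hdini : IntegrableOn (fun r => ω r / r) (Ioc (0:ℝ) 1)) :
    Tendsto (fun ρ => ρ * ∫ τ in Ioc ρ (1:ℝ), ω τ / τ ^ 2)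
      (nhdsWithin 0 (Ioi 0)) (nhds 0) := by
  have hg : AEStronglyMeasurable (fun τ => ω τ / τ ^ 2) (volume.restrict (Ioc (0:ℝ) 1)) := by
    have h1 : AEStronglyMeasurable (fun τ : ℝ => (ω τ / τ) * τ⁻¹)
        (volume.restrict (Ioc (0:ℝ) 1)) :=
      hdini.aestronglyMeasurable.mul (measurable_inv.aestronglyMeasurable)
    refine h1.congr (Eventually.of_forall fun τ => ?_)
    simp only [div_eq_mul_inv, pow_two, mul_inv, mul_assoc]
  have h := tendsto_integral_filter_of_dominated_convergence
    (μ := volume.restrict (Ioc (0:ℝ) 1)) (l := nhdsWithin (0:ℝ) (Ioi 0))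
    (F := fun ρ τ => ρ * (Ioi ρ).indicator (fun τ => ω τ / τ ^ 2) τ) (f := fun _ => (0:ℝ))
    (fun r => ω r / r)
    (Eventually.of_forall fun ρ => (hg.indicator measurableSet_Ioi).const_mul ρ)
    (by
      filter_upwards [self_mem_nhdsWithin] with ρ hρ
      filter_upwards [ae_restrict_mem measurableSet_Ioc] with τ hτ
      have hp := hpos τ hτ
      have h0 := hτ.1
      have hρ' : 0 < ρ := hρ
      by_cases hlt : ρ < τ
      · rw [indicator_of_mem (by exact hlt), Real.norm_of_nonneg (by positivity)]
        rw [mul_div_assoc', div_le_div_iff₀ (by positivity) h0]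
        nlinarith [mul_pos hp h0]
      · rw [indicator_of_notMem (by exact hlt)]
        simp only [mul_zero, norm_zero]
        positivity)
    hdini
    (by
      filter_upwards [ae_restrict_mem measurableSet_Ioc] with τ hτ
      have h1 : Tendsto (fun ρ : ℝ => ρ * (ω τ / τ ^ 2)) (nhdsWithin 0 (Ioi 0)) (nhds 0) := by
        have : Tendsto (fun ρ : ℝ => ρ * (ω τ / τ ^ 2)) (nhds 0) (nhds (0 * (ω τ / τ ^ 2))) :=
          tendsto_id.mul_const _
        rw [zero_mul] at this
        exact this.mono_left nhdsWithin_le_nhds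
      refine h1.congr' ?_
      have : ∀ᶠ ρ in nhdsWithin (0:ℝ) (Ioi 0), ρ < τ :=
        nhdsWithin_le_nhds (Iio_mem_nhds hτ.1)
      filter_upwards [this] with ρ hρ
      rw [indicator_of_mem (by exact hρ)])
  simp only [integral_zero] at h
  refine h.congr' ?_
  filter_upwards [self_mem_nhdsWithin] with ρ hρ
  rw [integral_const_mul, integral_indicator measurableSet_Ioi,
        Measure.restrict_restrict measurableSet_Ioi]
  congr 3
  ext x
  simp only [mem_inter_iff, mem_Ioi, mem_Ioc]
  constructor
  · rintro ⟨h1, h2, h3⟩; exact ⟨h1, h3⟩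
  · rintro ⟨h1, h2⟩; exact ⟨h1, lt_trans hρ h1, h2⟩

/-- integrability away from zero -/
lemma psi_aux_int (ω : ℝ → ℝ)
    (hpos : ∀ r ∈ Ioc (0:ℝ) 1, 0 < ω r)
    (hmono : ∀ r ∈ Ioc (0:ℝ) 1, ∀ s ∈ Ioc (0:ℝ) 1, r ≤ s → ω r ≤ ω s)
    (a b : ℕ) (ρ : ℝ) (hρ : 0 < ρ) :
    IntegrableOn (fun τ => ω τ ^ a / τ ^ b) (Ioc ρ 1) := by
  have hsub : Ioc ρ 1 ⊆ Ioc (0:ℝ) 1 := Ioc_subset_Ioc_left hρ.le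
  have hm : AEMeasurable ω (volume.restrict (Ioc ρ 1)) :=
    aemeasurable_restrict_of_monotoneOn measurableSet_Ioc
      (fun x hx y hy hxy => hmono x (hsub hx) y (hsub hy) hxy)
  refine Integrable.mono' (integrable_const (ω 1 ^ a / ρ ^ b))
    ((hm.pow_const a).div (measurable_id.pow_const b).aemeasurable).aestronglyMeasurable ?_
  filter_upwards [ae_restrict_mem measurableSet_Ioc] with τ hτ
  have h0 : 0 < τ := (hsub hτ).1
  have hp := hpos τ (hsub hτ)
  rw [Real.norm_of_nonneg (by positivity)]
  have h1 := hmono τ (hsub hτ) 1 (by simp) hτ.2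
  have h2 := hτ.1.le
  have h3 : 0 < ω 1 := hpos 1 (by simp)
  gcongr

/-- the pointwise bound -/
lemma psi_aux_bound (ω : ℝ → ℝ)
    (hpos : ∀ r ∈ Ioc (0:ℝ) 1, 0 < ω r)
    (hmono : ∀ r ∈ Ioc (0:ℝ) 1, ∀ s ∈ Ioc (0:ℝ) 1, r ≤ s → ω r ≤ ω s)
    (n : ℕ) (ρ : ℝ) (hρ : ρ ∈ Ioc (0:ℝ) 1) :
    ρ ^ n * (∫ τ in Ioc ρ (1:ℝ), ω τ ^ (3 * n + 4) / τ ^ (n + 3)) ≤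
      ω 1 ^ (3 * n + 2) * ((∫ τ in Ioc ρ (1:ℝ), ω τ / τ ^ 2) + ω 1) ^ 2 := by
  set H := ∫ τ in Ioc ρ (1:ℝ), ω τ / τ ^ 2 with hH
  have hρ0 := hρ.1
  have hW : 0 < ω 1 := hpos 1 (by simp)
  have hi : IntegrableOn (fun τ => ω τ / τ ^ 2) (Ioc ρ 1) := by
    simpa using psi_aux_int ω hpos hmono 1 2 ρ hρ0
  have hsub : Ioc ρ 1 ⊆ Ioc (0:ℝ) 1 := Ioc_subset_Ioc_left hρ0.le
  have hH0 : 0 ≤ H := setIntegral_nonneg measurableSet_Ioc fun τ hτ =>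
    div_nonneg (hpos τ (hsub hτ)).le (by positivity)
  have hsup : ∀ τ ∈ Ioc ρ 1, ω τ / τ ≤ H + ω 1 := by
    intro τ hτ
    have hτ0 := (hsub hτ).1
    have hs1 : Ioc τ 1 ⊆ Ioc ρ 1 := Ioc_subset_Ioc_left hτ.1.le
    have a1 : ∫ s in Ioc τ 1, ω s / s ^ 2 ≤ H := by
      refine setIntegral_mono_set hi ?_ (Eventually.of_forall hs1)
      filter_upwards [ae_restrict_mem measurableSet_Ioc] with s hs
      exact div_nonneg (hpos s (hsub hs)).le (by positivity)
    have hcint : IntegrableOn (fun s : ℝ => ω τ * (1 / s ^ 2)) (Ioc τ 1) := by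
      have := psi_aux_int ω hpos hmono 0 2 τ hτ0
      simp only [pow_zero] at this
      exact this.const_mul _
    have a2 : ∫ s in Ioc τ 1, ω τ * (1 / s ^ 2) ≤ ∫ s in Ioc τ 1, ω s / s ^ 2 := by
      refine setIntegral_mono_on hcint (hi.mono_set hs1) measurableSet_Ioc ?_
      intro s hs
      have := hmono τ (hsub hτ) s (hsub (hs1 hs)) hs.1.le
      rw [mul_one_div]
      gcongr
    have a3 : ∫ s in Ioc τ 1, (1 / s ^ 2) = 1 / τ - 1 := by
      rw [← intervalIntegral.integral_of_le hτ.2]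
      have hne : ∀ s ∈ uIcc τ 1, s ≠ 0 := by
        intro s hs
        rw [uIcc_of_le hτ.2] at hs
        exact (hτ0.trans_le hs.1).ne'
      have := intervalIntegral.integral_eq_sub_of_hasDerivAt (a := τ) (b := 1)
        (f := fun s : ℝ => -s⁻¹) (f' := fun s : ℝ => 1 / s ^ 2)
        (fun s hs => by
          have := (hasDerivAt_inv (hne s hs)).neg
          have e : (fun s : ℝ => -s⁻¹) = -fun s : ℝ => s⁻¹ := rfl
          rw [e]
          simpa using this)
        ((intervalIntegrable_iff_integrableOn_Ioc_of_le hτ.2).2 (by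
          simpa using psi_aux_int ω hpos hmono 0 2 τ hτ0))
      rw [this]
      simp
      ring
    rw [integral_const_mul, a3] at a2
    have a4 := hmono τ (hsub hτ) 1 (by simp) hτ.2
    have a5 : ω τ / τ = ω τ * (1 / τ - 1) + ω τ := by ring
    linarith
  calc ρ ^ n * (∫ τ in Ioc ρ (1:ℝ), ω τ ^ (3 * n + 4) / τ ^ (n + 3))
      = ∫ τ in Ioc ρ (1:ℝ), ρ ^ n * (ω τ ^ (3 * n + 4) / τ ^ (n + 3)) := by
        rw [integral_const_mul]
    _ ≤ ∫ τ in Ioc ρ (1:ℝ), (ω 1 ^ (3 * n + 2) * (H + ω 1)) * (ω τ / τ ^ 2) := by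
        refine setIntegral_mono_on ((psi_aux_int ω hpos hmono _ _ ρ hρ0).const_mul _)
          (hi.const_mul _) measurableSet_Ioc ?_
        intro τ hτ
        have hτ0 := (hsub hτ).1
        have hp := hpos τ (hsub hτ)
        have b1 := hmono τ (hsub hτ) 1 (by simp) hτ.2
        have b2 := hsup τ hτ
        have b3 := hτ.1.le
        calc ρ ^ n * (ω τ ^ (3 * n + 4) / τ ^ (n + 3))
            ≤ τ ^ n * (ω τ ^ (3 * n + 4) / τ ^ (n + 3)) := by gcongr
          _ = ω τ ^ (3 * n + 2) * (ω τ / τ) * (ω τ / τ ^ 2) := by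
              field_simp
              ring
          _ ≤ _ := by gcongr
    _ = ω 1 ^ (3 * n + 2) * (H + ω 1) * H := by rw [integral_const_mul]
    _ ≤ ω 1 ^ (3 * n + 2) * (H + ω 1) * (H + ω 1) := by gcongr; linarith
    _ = _ := by ring

/-- Parabolic analogue of the modulus (2.16): for a Dini modulus of continuity
`ω` and `n ≥ 1`, one has
`∫₀^{1/2} ρ^{(n+2)/2 − 1} ( ∫_ρ¹ ω(τ)^{3n+4}/τ^{n+3} dτ )^{1/2} dρ < ∞` and
`ρ^{n+2} ∫_ρ¹ ω(τ)^{3n+4}/τ^{n+3} dτ → 0` as `ρ → 0⁺`. -/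
theorem parabolic_psi_dini (ω : ℝ → ℝ)
    (hpos : ∀ r ∈ Ioc (0:ℝ) 1, 0 < ω r)
    (hmono : ∀ r ∈ Ioc (0:ℝ) 1, ∀ s ∈ Ioc (0:ℝ) 1, r ≤ s → ω r ≤ ω s)
    (hlim : Tendsto ω (nhdsWithin 0 (Ioi 0)) (nhds 0))
    (hdini : IntegrableOn (fun r => ω r / r) (Ioc (0:ℝ) 1))
    (n : ℕ) (hn : 1 ≤ n) :
    IntegrableOn
      (fun ρ => ρ ^ (((n : ℝ) + 2) / 2 - 1) *
        Real.sqrt (∫ τ in Ioc ρ (1:ℝ), ω τ ^ (3 * n + 4) / τ ^ (n + 3)))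
      (Ioc (0:ℝ) (1/2)) ∧
    Tendsto (fun ρ => ρ ^ (n + 2) * ∫ τ in Ioc ρ (1:ℝ), ω τ ^ (3 * n + 4) / τ ^ (n + 3))
      (nhdsWithin 0 (Ioi 0)) (nhds 0) := by
  have hW : 0 < ω 1 := hpos 1 (by simp)
  set F : ℝ → ℝ := fun ρ => ∫ τ in Ioc ρ (1:ℝ), ω τ ^ (3 * n + 4) / τ ^ (n + 3) with hF
  set H : ℝ → ℝ := fun ρ => ∫ τ in Ioc ρ (1:ℝ), ω τ / τ ^ 2 with hH
  have hF0 : ∀ ρ, 0 < ρ → 0 ≤ F ρ := fun ρ hρ =>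
    setIntegral_nonneg measurableSet_Ioc fun τ hτ => by
      have h0 : 0 < τ := hρ.trans hτ.1
      have := hpos τ ⟨h0, hτ.2⟩
      positivity
  have hH0 : ∀ ρ, 0 < ρ → 0 ≤ H ρ := fun ρ hρ =>
    setIntegral_nonneg measurableSet_Ioc fun τ hτ => by
      have h0 : 0 < τ := hρ.trans hτ.1
      have := hpos τ ⟨h0, hτ.2⟩
      positivity
  have hb : ∀ ρ ∈ Ioc (0:ℝ) 1, ρ ^ n * F ρ ≤ ω 1 ^ (3 * n + 2) * (H ρ + ω 1) ^ 2 :=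
    fun ρ hρ => psi_aux_bound ω hpos hmono n ρ hρ
  constructor
  · have hsub : Ioc (0:ℝ) (1/2) ⊆ Ioc 0 1 := Ioc_subset_Ioc_right (by norm_num)
    have hHi : IntegrableOn H (Ioc (0:ℝ) (1/2)) :=
      (psi_aux_H ω hpos hdini).mono_set hsub
    have hdom : IntegrableOn (fun ρ => Real.sqrt (ω 1 ^ (3 * n + 2)) * (H ρ + ω 1))
        (Ioc (0:ℝ) (1/2)) :=
      (hHi.add (integrableOn_const (by simp))).const_mul _
    have hFm : AEMeasurable F (volume.restrict (Ioc (0:ℝ) (1/2))) := by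
      refine aemeasurable_restrict_of_antitoneOn measurableSet_Ioc ?_
      intro x hx y hy hxy
      refine setIntegral_mono_set (psi_aux_int ω hpos hmono _ _ x hx.1) ?_
        (Eventually.of_forall (Ioc_subset_Ioc_left hxy))
      filter_upwards [ae_restrict_mem measurableSet_Ioc] with τ hτ
      have h0 : 0 < τ := hx.1.trans hτ.1
      have := hpos τ ⟨h0, hτ.2⟩
      simp only [Pi.zero_apply]
      positivity
    refine Integrable.mono' hdom ?_ ?_
    · exact ((measurable_id.pow_const _).aemeasurable.mul hFm.sqrt).aestronglyMeasurable
    · filter_upwards [ae_restrict_mem measurableSet_Ioc] with ρ hρ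
      have h0 := hρ.1
      have hH0' := hH0 ρ h0
      rw [Real.norm_of_nonneg (by positivity)]
      have e : ρ ^ (((n : ℝ) + 2) / 2 - 1) = Real.sqrt (ρ ^ n) := by
        rw [Real.sqrt_eq_rpow, ← Real.rpow_natCast, ← Real.rpow_mul h0.le]
        congr 1
        ring
      rw [e, ← Real.sqrt_mul (by positivity)]
      refine (Real.sqrt_le_sqrt (hb ρ (hsub hρ))).trans ?_
      rw [Real.sqrt_mul (by positivity), Real.sqrt_sq (by positivity)]
  · have h1 : Tendsto (fun ρ => ρ * H ρ) (nhdsWithin 0 (Ioi 0)) (nhds 0) :=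
      psi_aux_lim ω hpos hdini
    have h2 : Tendsto (fun ρ : ℝ => ρ * ω 1) (nhdsWithin 0 (Ioi 0)) (nhds 0) := by
      have : Tendsto (fun ρ : ℝ => ρ * ω 1) (nhds 0) (nhds (0 * ω 1)) :=
        tendsto_id.mul_const _
      rw [zero_mul] at this
      exact this.mono_left nhdsWithin_le_nhds
    have h3 := (((h1.add h2).pow 2).const_mul (ω 1 ^ (3 * n + 2)))
    simp only [add_zero, ne_eq, OfNat.ofNat_ne_zero, not_false_eq_true, zero_pow, mul_zero] at h3
    refine tendsto_of_tendsto_of_tendsto_of_le_of_le' tendsto_const_nhds h3 ?_ ?_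
    · filter_upwards [self_mem_nhdsWithin] with ρ hρ
      have hρ' : 0 < ρ := hρ
      exact mul_nonneg (by positivity) (hF0 ρ hρ')
    · have : ∀ᶠ ρ in nhdsWithin (0:ℝ) (Ioi 0), ρ < 1 :=
        nhdsWithin_le_nhds (Iio_mem_nhds one_pos)
      filter_upwards [self_mem_nhdsWithin, this] with ρ hρ hρ1
      have := hb ρ ⟨hρ, le_of_lt hρ1⟩
      have h5 := mul_le_mul_of_nonneg_left this (sq_nonneg ρ)
      calc ρ ^ (n + 2) * F ρ = ρ ^ 2 * (ρ ^ n * F ρ) := by ring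
        _ ≤ _ := h5
        _ = _ := by ring
end
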